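/- Fix η > 0, set Δ = cosh η, fix r ∈ ℝ, and for x ∈ ℤ write cos θ̄ₓ = tanh(η(x−r)), sin θ̄ₓ = 1/cosh(η(x−r)). Then for every x ∈ ℤ: 1 − Δ⁻¹·sin θ̄ₓ·sin θ̄_{x+1} − cos θ̄ₓ·cos θ̄_{x+1} + √(1−Δ⁻²)·(cos θ̄ₓ − cos θ̄_{x+1}) = 0. That is, each bond term of the classical XXZ Hamiltonian with kink boundary conditions vanishes on the kink configuration σ^{(r)}ₓ(φ) = (sin θ̄ₓ cos φ, sin θ̄ₓ sin φ, cos θ̄ₓ). -/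

import Mathlib

theorem Real.sqrt_one_sub_inv_cosh_sq {η : ℝ} (hη : 0 ≤ η) :
    Real.sqrt (1 - (Real.cosh η)⁻¹ ^ 2) = Real.tanh η := by
  have hC := (Real.cosh_pos η).ne'
  have h : 1 - (Real.cosh η)⁻¹ ^ 2 = Real.tanh η ^ 2 := by
    rw [Real.tanh_eq_sinh_div_cosh]
    field_simp
    linarith [Real.cosh_sq η]
  rw [h, Real.sqrt_sq]
  rw [Real.tanh_eq_sinh_div_cosh]
  exact div_nonneg (Real.sinh_nonneg_iff.2 hη) (Real.cosh_pos η).le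

theorem kink_bond_energy_eq_zero (a b : ℝ) :
    1 - (Real.cosh (b - a))⁻¹ * ((1 / Real.cosh a) * (1 / Real.cosh b)) -
      Real.tanh a * Real.tanh b + Real.tanh (b - a) * (Real.tanh a - Real.tanh b) = 0 := by
  have ha := (Real.cosh_pos a).ne'
  have hb := (Real.cosh_pos b).ne'
  have hC := (Real.cosh_pos (b - a)).ne'
  have h1 := Real.cosh_sub b a
  have h2 := Real.sinh_sub b a
  have h3 := Real.cosh_sq (b - a)
  simp only [Real.tanh_eq_sinh_div_cosh]
  field_simp
  linear_combination (-Real.cosh (b - a)) * h1 + Real.sinh (b - a) * h2 + h3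

/-- Each bond term of the classical XXZ Hamiltonian with kink boundary conditions
vanishes on the kink configuration with `cos θ̄ₓ = tanh(η(x-r))`,
`sin θ̄ₓ = 1/cosh(η(x-r))`, `Δ = cosh η`:
`1 − Δ⁻¹ sin θ̄ₓ sin θ̄_{x+1} − cos θ̄ₓ cos θ̄_{x+1} + √(1−Δ⁻²)(cos θ̄ₓ − cos θ̄_{x+1}) = 0`. -/
theorem classical_bond_energy_zero (η r : ℝ) (hη : 0 < η) (Δ : ℝ) (hΔ : Δ = Real.cosh η) :
    ∀ x : ℤ,
      1 - Δ⁻¹ * ((1 / Real.cosh (η * ((x : ℝ) - r))) * (1 / Real.cosh (η * ((x : ℝ) + 1 - r)))) -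
          Real.tanh (η * ((x : ℝ) - r)) * Real.tanh (η * ((x : ℝ) + 1 - r)) +
          Real.sqrt (1 - (Δ⁻¹) ^ 2) *
            (Real.tanh (η * ((x : ℝ) - r)) - Real.tanh (η * ((x : ℝ) + 1 - r))) = 0 := by
  intro x
  have hb : η * ((x : ℝ) + 1 - r) - η * ((x : ℝ) - r) = η := by ring
  have h := kink_bond_energy_eq_zero (η * ((x : ℝ) - r)) (η * ((x : ℝ) + 1 - r))
  rw [hb] at h
  rw [hΔ, Real.sqrt_one_sub_inv_cosh_sq hη.le]
  exact h
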